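/- Let S be a finite family of pairwise disjoint closed axis-parallel unit squares in ℝ², let ℓ be a horizontal line, and let I(ℓ) = {s ∈ S : s ∩ ℓ ≠ ∅}. Define B(I(ℓ)) to be the set of horizontal lines {y = y_s : s ∈ I(ℓ)} ∪ {y = y_s + 1 : s ∈ I(ℓ)}, where y_s denotes the lower-left y-coordinate of square s. Then for every horizontal line ℓ' that intersects at least two squares of I(ℓ), there exists a line ℓ* ∈ B(I(ℓ)) that dominates ℓ', i.e., every square of S intersected by ℓ' is also intersected by ℓ*. -/

import Mathlib

/-- The horizontal line `y = c`. -/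
def hLine (c : ℝ) : Set (ℝ × ℝ) := {p : ℝ × ℝ | p.2 = c}

/-- The closed axis-parallel unit square with lower-left corner `(x, y)`. -/
def closedSquare (x y : ℝ) : Set (ℝ × ℝ) := Set.Icc x (x + 1) ×ˢ Set.Icc y (y + 1)

theorem hLine_inter_iff (c x y : ℝ) :
    (hLine c ∩ closedSquare x y).Nonempty ↔ y ≤ c ∧ c ≤ y + 1 := by
  constructor
  · rintro ⟨p, hp, hq⟩
    have h1 : p.2 = c := hp
    have h2 := hq.2
    rw [h1] at h2
    exact h2
  · intro h
    exact ⟨(x, c), rfl, ⟨⟨le_refl x, by simp⟩, h⟩⟩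

/-- Any horizontal line `ℓ'` meeting at least two squares of `I(ℓ)` (for a horizontal
line `ℓ`) is dominated by a line of `B(I(ℓ))`, i.e., by a horizontal line through the
bottom side or the top side of a square of `I(ℓ)`. -/
theorem dominating_line_exists (S : Finset (ℝ × ℝ))
    (hdisj : ∀ s ∈ S, ∀ s' ∈ S, s ≠ s' →
      Disjoint (closedSquare s.1 s.2) (closedSquare s'.1 s'.2))
    (yl c' : ℝ)
    (htwo : ∃ s ∈ S, ∃ s' ∈ S, s ≠ s' ∧
      (hLine yl ∩ closedSquare s.1 s.2).Nonempty ∧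
      (hLine yl ∩ closedSquare s'.1 s'.2).Nonempty ∧
      (hLine c' ∩ closedSquare s.1 s.2).Nonempty ∧
      (hLine c' ∩ closedSquare s'.1 s'.2).Nonempty) :
    ∃ c : ℝ,
      (∃ s ∈ S, (hLine yl ∩ closedSquare s.1 s.2).Nonempty ∧
        (c = s.2 ∨ c = s.2 + 1)) ∧
      ∀ s ∈ S, (hLine c' ∩ closedSquare s.1 s.2).Nonempty →
        (hLine c ∩ closedSquare s.1 s.2).Nonempty := by
  simp only [hLine_inter_iff] at *
  obtain ⟨s, hs, -, -, -, hl, -, hc, -⟩ := htwo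
  have hne : (S.filter (fun t => t.2 ≤ c' ∧ c' ≤ t.2 + 1)).Nonempty :=
    ⟨s, Finset.mem_filter.2 ⟨hs, hc⟩⟩
  rcases le_total yl c' with h | h
  · obtain ⟨m, hm, hmin⟩ := Finset.exists_min_image _ (fun t : ℝ × ℝ => t.2) hne
    have hsm := hmin s (Finset.mem_filter.2 ⟨hs, hc⟩)
    obtain ⟨hmS, hm1, hm2⟩ := Finset.mem_filter.1 hm
    refine ⟨m.2 + 1, ⟨m, hmS, ⟨by linarith, by linarith⟩, Or.inr rfl⟩, fun t ht htc => ?_⟩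
    have := hmin t (Finset.mem_filter.2 ⟨ht, htc⟩)
    exact ⟨by linarith, by linarith⟩
  · obtain ⟨m, hm, hmax⟩ := Finset.exists_max_image _ (fun t : ℝ × ℝ => t.2) hne
    have hsm := hmax s (Finset.mem_filter.2 ⟨hs, hc⟩)
    obtain ⟨hmS, hm1, hm2⟩ := Finset.mem_filter.1 hm
    refine ⟨m.2, ⟨m, hmS, ⟨by linarith, by linarith⟩, Or.inl rfl⟩, fun t ht htc => ?_⟩
    have := hmax t (Finset.mem_filter.2 ⟨ht, htc⟩)
    exact ⟨by linarith, by linarith⟩
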